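/- Let K be a field and m, n positive integers. Every pre-interval representation V of the equioriented commutative grid G_{m,n} is isomorphic to the interval representation V_I where I = supp(V). -/

import Mathlib

open Classical

structure PRep (K : Type) [Field K] (P : Type) [PartialOrder P] : Type 1 where
  V : P → Type
  [isAddCommGroup : ∀ x, AddCommGroup (V x)]
  [isModule : ∀ x, Module K (V x)]
  [isFinite : ∀ x, Module.Finite K (V x)]
  map : ∀ {x y : P}, x ≤ y → (V x →ₗ[K] V y)
  map_refl : ∀ x : P, map (le_refl x) = LinearMap.id
  map_trans : ∀ {x y z : P} (hxy : x ≤ y) (hyz : y ≤ z),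
    map (le_trans hxy hyz) = (map hyz).comp (map hxy)

attribute [instance] PRep.isAddCommGroup PRep.isModule PRep.isFinite

variable {K : Type} [Field K] {P : Type} [PartialOrder P]

namespace PRep

/-- Isomorphism of representations. -/
def Iso (M N : PRep K P) : Prop :=
  ∃ e : ∀ x : P, M.V x ≃ₗ[K] N.V x,
    ∀ (x y : P) (h : x ≤ y),
      (N.map h).comp (e x : M.V x →ₗ[K] N.V x)
        = (e y : M.V y →ₗ[K] N.V y).comp (M.map h)

/-- Pointwise direct sum of two representations. -/
def dsum (M N : PRep K P) : PRep K P where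
  V x := M.V x × N.V x
  map h := (M.map h).prodMap (N.map h)
  map_refl x := by
    apply LinearMap.ext; intro v
    simp [M.map_refl, N.map_refl]
  map_trans hxy hyz := by
    apply LinearMap.ext; intro v
    simp [M.map_trans hxy hyz, N.map_trans hxy hyz]

def IsThin (M : PRep K P) : Prop := ∀ x : P, Module.finrank K (M.V x) ≤ 1

def supp (M : PRep K P) : Set P := {x : P | Nontrivial (M.V x)}

def Indecomposable (M : PRep K P) : Prop :=
  (∃ x : P, Nontrivial (M.V x)) ∧
  ∀ N₁ N₂ : PRep K P, M.Iso (N₁.dsum N₂) →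
    (∀ x : P, Subsingleton (N₁.V x)) ∨ (∀ x : P, Subsingleton (N₂.V x))

end PRep

/-- Convexity of a subset of a poset. -/
def IsConvexSet (I : Set P) : Prop :=
  ∀ ⦃a b c : P⦄, a ∈ I → c ∈ I → a ≤ b → b ≤ c → b ∈ I

/-- Connectedness of a subset of a poset. -/
def IsConnectedSet (I : Set P) : Prop :=
  ∀ a ∈ I, ∀ b ∈ I,
    Relation.ReflTransGen (fun u v : P => u ∈ I ∧ v ∈ I ∧ (u ≤ v ∨ v ≤ u)) a b

/-- An interval of a poset: nonempty, convex and connected subset. -/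
def IsIntervalSet (I : Set P) : Prop :=
  I.Nonempty ∧ IsConvexSet I ∧ IsConnectedSet I

/-- The interval representation associated to a convex subset `I`. -/
noncomputable def intervalRep (K : Type) [Field K] {P : Type} [PartialOrder P]
    (I : Set P) (hI : IsConvexSet I) : PRep K P where
  V x := ↥(if x ∈ I then (⊤ : Submodule K K) else ⊥)
  map {x y} h :=
    { toFun := fun v => ⟨if y ∈ I then (v : K) else 0, by
        by_cases hy : y ∈ I
        · simp only [if_pos hy]; exact Submodule.mem_top
        · simp only [if_neg hy]; exact Submodule.zero_mem _⟩
      map_add' := fun v w => by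
        apply Subtype.ext
        by_cases hy : y ∈ I <;> simp [hy]
      map_smul' := fun c v => by
        apply Subtype.ext
        by_cases hy : y ∈ I <;> simp [hy] }
  map_refl x := by
    apply LinearMap.ext; intro v
    apply Subtype.ext
    by_cases hx : x ∈ I
    · simp [hx]
    · have hv0 : (v : K) = 0 := (Submodule.mem_bot K).1 ((le_of_eq (if_neg hx) : (if x ∈ I then (⊤ : Submodule K K) else ⊥) ≤ ⊥) v.2)
      show (if x ∈ I then (v : K) else 0) = (v : K)
      rw [if_neg hx, hv0]
  map_trans {x y z} hxy hyz := by
    apply LinearMap.ext; intro v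
    apply Subtype.ext
    by_cases hz : z ∈ I
    · by_cases hy : y ∈ I
      · show (if z ∈ I then (v : K) else 0)
          = if z ∈ I then (if y ∈ I then (v : K) else 0) else 0
        rw [if_pos hy]
      · by_cases hx : x ∈ I
        · exact absurd (hI hx hz hxy hyz) hy
        · have hv0 : (v : K) = 0 := (Submodule.mem_bot K).1 ((le_of_eq (if_neg hx) : (if x ∈ I then (⊤ : Submodule K K) else ⊥) ≤ ⊥) v.2)
          simp [hz, hy, hv0]
    · simp [hz]

namespace PRep

def IsPreInterval (M : PRep K P) : Prop :=
  M.IsThin ∧ IsIntervalSet M.supp ∧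
    ∀ (x y : P) (h : x ≤ y), x ∈ M.supp → y ∈ M.supp → M.map h ≠ 0

end PRep

namespace PRep

/-- In a thin representation every vector is a multiple of a given nonzero one. -/
theorem IsThin.exists_smul_eq {M : PRep K P} (hM : M.IsThin) {x : P} {v : M.V x} (hv : v ≠ 0)
    (w : M.V x) : ∃ c : K, c • v = w := by
  have : Nontrivial (M.V x) := ⟨v, 0, hv⟩
  exact exists_smul_eq_of_finrank_eq_one (le_antisymm (hM x) Module.finrank_pos) hv w

theorem IsPreInterval.map_ne_zero {M : PRep K P} (hM : M.IsPreInterval) {x y : P} (h : x ≤ y)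
    (hx : x ∈ M.supp) (hy : y ∈ M.supp) {v : M.V x} (hv : v ≠ 0) : M.map h v ≠ 0 := by
  intro h0
  refine hM.2.2 x y h hx hy (LinearMap.ext fun w => ?_)
  obtain ⟨c, rfl⟩ := hM.1.exists_smul_eq hv w
  simp [h0]

theorem IsPreInterval.map_injective {M : PRep K P} (hM : M.IsPreInterval) {x y : P} (h : x ≤ y)
    (hx : x ∈ M.supp) (hy : y ∈ M.supp) : Function.Injective (M.map h) := by
  rw [injective_iff_map_eq_zero]
  intro v hv
  by_contra h0
  exact hM.map_ne_zero h hx hy h0 hv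

theorem IsPreInterval.map_surjective {M : PRep K P} (hM : M.IsPreInterval) {x y : P} (h : x ≤ y)
    (hx : x ∈ M.supp) (hy : y ∈ M.supp) : Function.Surjective (M.map h) := by
  intro w
  have : Nontrivial (M.V x) := hx
  obtain ⟨v, hv⟩ := exists_ne (0 : M.V x)
  obtain ⟨c, hc⟩ := hM.1.exists_smul_eq (hM.map_ne_zero h hx hy hv) w
  exact ⟨c • v, by simpa using hc⟩

theorem map_map (M : PRep K P) {x y z : P} (hxy : x ≤ y) (hyz : y ≤ z) (v : M.V x) :
    M.map hyz (M.map hxy v) = M.map (hxy.trans hyz) v := by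
  rw [M.map_trans hxy hyz, LinearMap.comp_apply]

/-- A family of vectors, nonzero and preserved by the structure maps on the support. -/
def IsCompatibleOn (M : PRep K P) (S : Set P) (v : ∀ x, M.V x) : Prop :=
  (∀ x ∈ S, x ∈ M.supp → v x ≠ 0) ∧
    ∀ (x y : P) (h : x ≤ y), x ∈ S → y ∈ S → x ∈ M.supp → y ∈ M.supp → M.map h (v x) = v y

/-- A thin representation with a compatible family of vectors is the interval representation
on its support. -/
theorem IsThin.iso_intervalRep {M : PRep K P} (hM : M.IsThin) (hI : IsConvexSet M.supp)
    {v : ∀ x, M.V x} (hv : M.IsCompatibleOn Set.univ v) : M.Iso (intervalRep K M.supp hI) := by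
  have hzero : ∀ x, x ∉ M.supp →
      ∀ t : ↥(if x ∈ M.supp then (⊤ : Submodule K K) else ⊥), (t : K) = 0 := by
    intro x hx t
    exact (Submodule.mem_bot K).1 ((le_of_eq (if_neg hx) :
      (if x ∈ M.supp then (⊤ : Submodule K K) else ⊥) ≤ ⊥) t.2)
  let g : ∀ x, ↥(if x ∈ M.supp then (⊤ : Submodule K K) else ⊥) →ₗ[K] M.V x := fun x =>
    (LinearMap.toSpanSingleton K _ (v x)).comp (Submodule.subtype _)
  have hbij : ∀ x, Function.Bijective (g x) := by
    intro x
    by_cases hx : x ∈ M.supp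
    · constructor
      · intro s t hst
        exact Subtype.ext (smul_left_injective K (hv.1 x trivial hx) hst)
      · intro w
        obtain ⟨c, hc⟩ := hM.exists_smul_eq (hv.1 x trivial hx) w
        exact ⟨⟨c, by simp only [if_pos hx]; exact Submodule.mem_top⟩, hc⟩
    · have : Subsingleton (M.V x) := not_nontrivial_iff_subsingleton.1 hx
      exact ⟨fun s t _ => Subtype.ext ((hzero x hx s).trans (hzero x hx t).symm),
        fun w => ⟨0, Subsingleton.elim _ _⟩⟩
  let E := fun x => LinearEquiv.ofBijective (g x) (hbij x)
  have hE : ∀ x t, E x t = (t : K) • v x := fun x t => rfl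
  refine ⟨fun x => (E x).symm, fun x y h => LinearMap.ext fun w => ?_⟩
  obtain ⟨t, rfl⟩ := (E x).surjective w
  change (intervalRep K M.supp hI).map h ((E x).symm (E x t)) = (E y).symm (M.map h (E x t))
  rw [LinearEquiv.symm_apply_apply]
  refine ((LinearEquiv.symm_apply_eq _).2 ?_).symm
  rw [hE, map_smul]
  change (t : K) • M.map h (v x) = (if y ∈ M.supp then (t : K) else 0) • v y
  by_cases hy : y ∈ M.supp
  · rw [if_pos hy]
    by_cases hx : x ∈ M.supp
    · rw [hv.2 x y h trivial trivial hx hy]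
    · rw [hzero x hx t, zero_smul, zero_smul]
  · have : Subsingleton (M.V y) := not_nontrivial_iff_subsingleton.1 hy
    exact Subsingleton.elim _ _

/-- A compatible family on the rows below `k` of a grid extends to row `k`: the vectors there are
determined by the one at the last element of the support in that row. -/
theorem IsPreInterval.exists_isCompatibleOn_Iic {m n : ℕ} {M : PRep K (Fin m × Fin n)}
    (hM : M.IsPreInterval) (k : Fin m) {v : ∀ x, M.V x}
    (hv : M.IsCompatibleOn {x | x.1 < k} v) : ∃ w, M.IsCompatibleOn {x | x.1 ≤ k} w := by
  obtain ⟨hv0, hvm⟩ := hv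
  have hconv := hM.2.1.2.1
  by_cases hrow : ∃ j, (k, j) ∈ M.supp
  swap
  · have hlt : ∀ x : Fin m × Fin n, x.1 ≤ k → x ∈ M.supp → x.1 < k := fun x hx hxs =>
      lt_of_le_of_ne hx fun he => hrow ⟨x.2, he ▸ hxs⟩
    exact ⟨v, fun x hx hxs => hv0 x (hlt x hx hxs) hxs, fun x y h hx hy hxs hys =>
      hvm x y h (hlt x hx hxs) (hlt y hy hys) hxs hys⟩
  obtain ⟨b, hb, hmax⟩ : ∃ b, (k, b) ∈ M.supp ∧ ∀ j, (k, j) ∈ M.supp → j ≤ b := by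
    obtain ⟨b, hb, hmax⟩ := Set.exists_max_image {j | (k, j) ∈ M.supp} id (Set.toFinite _) hrow
    exact ⟨b, hb, hmax⟩
  obtain ⟨s, hs0, hs⟩ : ∃ s : M.V (k, b), s ≠ 0 ∧
      ∀ (x) (h : x ≤ (k, b)), x.1 < k → x ∈ M.supp → M.map h (v x) = s := by
    by_cases hex : ∃ x, x ≤ (k, b) ∧ x.1 < k ∧ x ∈ M.supp
    · obtain ⟨x, hx, hxk, hxs⟩ := hex
      refine ⟨M.map hx (v x), hM.map_ne_zero hx hxs hb (hv0 x hxk hxs), fun y hy hyk hys => ?_⟩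
      have hsup : x ⊔ y ≤ (k, b) := sup_le hx hy
      have hsupk : (x ⊔ y).1 < k := max_lt hxk hyk
      have hsups : x ⊔ y ∈ M.supp := hconv hxs hb le_sup_left hsup
      rw [← M.map_map le_sup_left hsup (v x), ← M.map_map le_sup_right hsup (v y),
        hvm _ _ _ hxk hsupk hxs hsups, hvm _ _ _ hyk hsupk hys hsups]
    · have : Nontrivial (M.V (k, b)) := hb
      obtain ⟨s, hs⟩ := exists_ne (0 : M.V (k, b))
      exact ⟨s, hs, fun x h hx hxs => absurd ⟨x, h, hx, hxs⟩ hex⟩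
  have hle : ∀ x : Fin m × Fin n, x.1 = k → x ∈ M.supp → x ≤ (k, b) := fun x hx hxs =>
    ⟨hx.le, hmax x.2 (hx ▸ hxs)⟩
  have hw : ∀ x, ∃ w : M.V x, (x.1 < k → w = v x) ∧
      (x.1 = k → x ∈ M.supp → ∀ h : x ≤ (k, b), M.map h w = s) := by
    intro x
    by_cases hx : x.1 = k ∧ x ∈ M.supp
    · obtain ⟨w, hw⟩ := hM.map_surjective (hle x hx.1 hx.2) hx.2 hb s
      exact ⟨w, fun h => absurd hx.1 h.ne, fun _ _ _ => hw⟩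
    · exact ⟨v x, fun _ => rfl, fun h hs => absurd ⟨h, hs⟩ hx⟩
  choose w hwlt hweq using hw
  have hws : ∀ (x) (h : x ≤ (k, b)), x ∈ M.supp → M.map h (w x) = s := by
    intro x h hxs
    rcases h.1.lt_or_eq with hx | hx
    · rw [hwlt x hx, hs x h hx hxs]
    · exact hweq x hx hxs h
  refine ⟨w, fun x hx hxs => ?_, fun x y h hx hy hxs hys => ?_⟩
  · rcases (show x.1 ≤ k from hx).lt_or_eq with hx | hx
    · rw [hwlt x hx]
      exact hv0 x hx hxs
    · intro h0
      apply hs0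
      rw [← hweq x hx hxs (hle x hx hxs), h0, map_zero]
  · rcases (show y.1 ≤ k from hy).lt_or_eq with hy | hy
    · have hx : x.1 < k := h.1.trans_lt hy
      rw [hwlt x hx, hwlt y hy, hvm x y h hx hy hxs hys]
    · have hyb := hle y hy hys
      apply hM.map_injective hyb hys hb
      rw [M.map_map, hws x _ hxs, hws y _ hys]

theorem IsPreInterval.exists_isCompatibleOn_univ {m n : ℕ} {M : PRep K (Fin m × Fin n)}
    (hM : M.IsPreInterval) : ∃ v, M.IsCompatibleOn Set.univ v := by
  have key : ∀ k : ℕ, ∃ v, M.IsCompatibleOn {x | (x.1 : ℕ) < k} v := by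
    intro k
    induction k with
    | zero => exact ⟨fun _ => 0, fun x hx => absurd hx (Nat.not_lt_zero _),
        fun x _ _ hx => absurd hx (Nat.not_lt_zero _)⟩
    | succ k ih =>
      obtain ⟨v, hv⟩ := ih
      by_cases hk : k < m
      · obtain ⟨w, hw⟩ := hM.exists_isCompatibleOn_Iic ⟨k, hk⟩ hv
        exact ⟨w, fun x hx => hw.1 x (Nat.lt_succ_iff.1 hx), fun x y h hx hy =>
          hw.2 x y h (Nat.lt_succ_iff.1 hx) (Nat.lt_succ_iff.1 hy)⟩
      · have hlt : ∀ x : Fin m × Fin n, (x.1 : ℕ) < k := fun x => by omega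
        exact ⟨v, fun x _ => hv.1 x (hlt x), fun x y h _ _ => hv.2 x y h (hlt x) (hlt y)⟩
  obtain ⟨v, hv⟩ := key m
  exact ⟨v, fun x _ => hv.1 x x.1.2, fun x y h _ _ => hv.2 x y h x.1.2 y.1.2⟩

end PRep

/-- Every pre-interval representation of the equioriented
commutative grid `G_{m,n}` is isomorphic to the interval representation on its
support. -/
theorem preinterval_iso_interval (K : Type) [Field K] (m n : ℕ)
    (hm : 0 < m) (hn : 0 < n) (V : PRep K (Fin m × Fin n))
    (hV : V.IsPreInterval) :
    V.Iso (intervalRep K V.supp hV.2.1.2.1) := by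
  obtain ⟨v, hv⟩ := PRep.IsPreInterval.exists_isCompatibleOn_univ hV
  exact PRep.IsThin.iso_intervalRep hV.1 _ hv
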